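/- For every integer ℓ ≥ 1, twice the Gromov–Hausdorff distance between S^1 and S^{2ℓ+1} equals 2πℓ/(2ℓ+1); that is, the infimum over all correspondences R ⊆ S^1 × S^{2ℓ+1} of dis(R) equals 2πℓ/(2ℓ+1). -/

import Mathlib

open Real

noncomputable section

/-- Euclidean space ℝ^d. -/
abbrev Euc (d : ℕ) : Type := EuclideanSpace ℝ (Fin d)

/-- The unit sphere S^n = {x ∈ ℝ^{n+1} : ⟨x,x⟩ = 1}. -/
def usphere (n : ℕ) : Set (Euc (n+1)) := {x | @inner ℝ _ _ x x = (1:ℝ)}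

/-- The geodesic distance d(x,y) = arccos⟨x,y⟩. -/
def geoDist {d : ℕ} (x y : Euc d) : ℝ := Real.arccos (@inner ℝ _ _ x y)

/-- A correspondence between A ⊆ ℝ^{d₁} and B ⊆ ℝ^{d₂}: a relation R ⊆ A × B whose
coordinate projections to A and B are both surjective. -/
def IsCorrespondence {d₁ d₂ : ℕ} (A : Set (Euc d₁)) (B : Set (Euc d₂))
    (R : Set (Euc d₁ × Euc d₂)) : Prop :=
  (∀ z ∈ R, z.1 ∈ A ∧ z.2 ∈ B) ∧
  (∀ a ∈ A, ∃ b ∈ B, (a, b) ∈ R) ∧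
  (∀ b ∈ B, ∃ a ∈ A, (a, b) ∈ R)

/-- The distortion of a relation, with respect to the geodesic metrics:
dis(R) = sup |d(x,x') − d(y,y')| over (x,y), (x',y') ∈ R. -/
def distortion {d₁ d₂ : ℕ} (R : Set (Euc d₁ × Euc d₂)) : ℝ :=
  sSup {t | ∃ z ∈ R, ∃ w ∈ R, t = |geoDist z.1 w.1 - geoDist z.2 w.2|}

/-- Twice the Gromov–Hausdorff distance between S^n and S^k (geodesic metrics),
via the Kalton–Ostrovskii formula: the infimum of dis(R) over all correspondences R. -/
def twoGH (n k : ℕ) : ℝ :=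
  sInf {t | ∃ R : Set (Euc (n+1) × Euc (k+1)),
    IsCorrespondence (usphere n) (usphere k) R ∧ t = distortion R}

/-- The sum of a mod 2 cochain over the facets of an ordered simplex. -/
def faceSum {α : Type*} : List α → (List α → ZMod 2) → ZMod 2
  | [], _ => 0
  | v :: l, β => β l + faceSum l fun l' => β (v :: l')

/-- The sum of a mod 2 cochain over the simplices of the prism between `l.map φ` and
`l.map ψ`. -/
def prismSum {α : Type*} (φ ψ : α → α) : List α → (List α → ZMod 2) → ZMod 2
  | [], _ => 0
  | v :: l, β => β (φ v :: ψ v :: l.map ψ) + prismSum φ ψ l fun l' => β (φ v :: l')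

section Chains

variable {α γ : Type*}

lemma faceSum_add (l : List α) (β β' : List α → ZMod 2) :
    faceSum l (fun x => β x + β' x) = faceSum l β + faceSum l β' := by
  induction l generalizing β β' with
  | nil => simp [faceSum]
  | cons v l ih => simp only [faceSum, ih]; ring

lemma faceSum_sum {ι : Type*} (s : Finset ι) (l : List α) (β : ι → List α → ZMod 2) :
    faceSum l (fun x => ∑ i ∈ s, β i x) = ∑ i ∈ s, faceSum l (β i) := by
  induction l generalizing β with
  | nil => simp [faceSum]
  | cons v l ih => simp only [faceSum, ih, Finset.sum_add_distrib]

lemma faceSum_map (f : α → γ) (l : List α) (β : List γ → ZMod 2) :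
    faceSum (l.map f) β = faceSum l fun x => β (x.map f) := by
  induction l generalizing β with
  | nil => rfl
  | cons v l ih => simp only [List.map_cons, faceSum, ih]

lemma faceSum_congr {l : List α} {β β' : List α → ZMod 2}
    (h : ∀ x, x.Sublist l → β x = β' x) : faceSum l β = faceSum l β' := by
  induction l generalizing β β' with
  | nil => rfl
  | cons v l ih =>
    simp only [faceSum]
    rw [h l (List.sublist_cons_self v l), ih fun x hx => h _ (hx.cons_cons v)]

lemma faceSum_perm {l l' : List α} (hl : l.Perm l') {β : List α → ZMod 2}
    (hβ : ∀ x y, x.Perm y → β x = β y) : faceSum l β = faceSum l' β := by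
  induction hl generalizing β with
  | nil => rfl
  | cons v h ih =>
    simp only [faceSum]
    rw [hβ _ _ h, ih fun x y hxy => hβ _ _ (hxy.cons v)]
  | swap v w l =>
    simp only [faceSum]
    rw [faceSum_congr fun x _ => hβ _ _ (List.Perm.swap v w x)]
    ring
  | trans _ _ ih₁ ih₂ => rw [ih₁ hβ, ih₂ hβ]

lemma prismSum_add (φ ψ : α → α) (l : List α) (β β' : List α → ZMod 2) :
    prismSum φ ψ l (fun x => β x + β' x) = prismSum φ ψ l β + prismSum φ ψ l β' := by
  induction l generalizing β β' with
  | nil => simp [prismSum]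
  | cons v l ih => simp only [prismSum, ih]; ring

lemma prismSum_congr {φ ψ : α → α} {l : List α} {β β' : List α → ZMod 2}
    (h : ∀ x : List α, x.length = l.length + 1 →
      (∀ z ∈ x, ∃ v ∈ l, z = φ v ∨ z = ψ v) → β x = β' x) :
    prismSum φ ψ l β = prismSum φ ψ l β' := by
  induction l generalizing β β' with
  | nil => rfl
  | cons v l ih =>
    simp only [prismSum]
    congr 1
    · refine h _ (by simp) ?_
      simp only [List.mem_cons, List.mem_map]
      grind
    · refine ih fun x hx hz => h _ (by simp [hx]) ?_
      simp only [List.mem_cons]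
      grind

/-- The prism operator is a mod 2 chain homotopy. -/
lemma prismSum_faceSum (φ ψ : α → α) (l : List α) (β : List α → ZMod 2) :
    prismSum φ ψ l (fun x => faceSum x β) =
      β (l.map ψ) + β (l.map φ) + faceSum l fun x => prismSum φ ψ x β := by
  induction l generalizing β with
  | nil => simp [prismSum, faceSum, CharTwo.add_self_eq_zero]
  | cons v l ih =>
    simp only [prismSum, faceSum, prismSum_add, ih, faceSum_add, faceSum_map, List.map_cons]
    linear_combination (CharTwo.add_self_eq_zero (β (φ v :: l.map ψ)))

end Chains

/-- Mod 2 indicator of the lists whose signs alternate, starting with `b`. -/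
def altSigns {α : Type*} (s : α → Bool) : Bool → List α → ZMod 2
  | _, [] => 1
  | b, v :: l => if s v = b then altSigns s (!b) l else 0

section Alternating

lemma faceSum_altSigns {α : Type*} (s : α → Bool) (b : Bool) (l : List α) :
    faceSum l (altSigns s b) = altSigns s b l + altSigns s (!b) l := by
  induction l generalizing b with
  | nil => simp [faceSum, altSigns, CharTwo.add_self_eq_zero]
  | cons v l ih =>
    have h0 : faceSum l (fun _ => 0) = 0 := by
      simpa using faceSum_add l (fun _ => 0) (fun _ => 0)
    by_cases h : s v = b
    · simp only [faceSum, altSigns, h, if_true, ih]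
      simp only [Bool.not_not, Bool.eq_not_self, if_false]
      linear_combination (CharTwo.add_self_eq_zero (altSigns s b l))
    · have h' : s v = !b := by rwa [Bool.eq_not_iff]
      simp [faceSum, altSigns, h', h0]

/-- A signed key `(θ, s)`, ordered by `θ` first. -/
abbrev SignedKey : Type := ℝ ×ₗ Bool

/-- The key of a signed key. -/
def SignedKey.key (p : SignedKey) : ℝ := (ofLex p).1

/-- The sign of a signed key. -/
def SignedKey.sign (p : SignedKey) : Bool := (ofLex p).2

/-- Reverse the sign of a signed key. -/
def SignedKey.flip (p : SignedKey) : SignedKey := toLex (p.key, !p.sign)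

@[simp] lemma SignedKey.key_flip (p : SignedKey) : p.flip.key = p.key := rfl

@[simp] lemma SignedKey.sign_flip (p : SignedKey) : p.flip.sign = !p.sign := rfl

lemma SignedKey.le_iff (p q : SignedKey) :
    p ≤ q ↔ p.key < q.key ∨ p.key = q.key ∧ p.sign ≤ q.sign :=
  Prod.Lex.le_iff

lemma SignedKey.key_le {p q : SignedKey} (h : p ≤ q) : p.key ≤ q.key := by
  rcases (SignedKey.le_iff p q).1 h with h | h
  exacts [h.le, h.1.le]

/-- Mod 2 indicator of the lists of signed keys whose signs alternate, starting with `true`,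
once sorted by key. -/
def sortedAlt (l : List SignedKey) : ZMod 2 :=
  altSigns SignedKey.sign true (l.insertionSort (· ≤ ·))

lemma altSigns_map_flip (b : Bool) (l : List SignedKey) :
    altSigns SignedKey.sign b (l.map SignedKey.flip) = altSigns SignedKey.sign (!b) l := by
  induction l generalizing b with
  | nil => rfl
  | cons v l ih =>
    simp only [List.map_cons, altSigns, ih, SignedKey.sign_flip]
    rcases b <;> rcases v.sign <;> rfl

lemma sortedAlt_perm {l l' : List SignedKey} (h : l.Perm l') : sortedAlt l = sortedAlt l' := by
  unfold sortedAlt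
  congr 1
  exact List.Perm.eq_of_pairwise' (List.pairwise_insertionSort _ _)
    (List.pairwise_insertionSort _ _)
    ((List.perm_insertionSort _ l).trans (h.trans (List.perm_insertionSort _ l').symm))

lemma faceSum_sortedAlt_eq (l : List SignedKey) :
    faceSum l sortedAlt =
      sortedAlt l + altSigns SignedKey.sign false (l.insertionSort (· ≤ ·)) := by
  rw [← faceSum_perm (List.perm_insertionSort (· ≤ ·) l) fun x y h => sortedAlt_perm h]
  have h : faceSum (l.insertionSort (· ≤ ·)) sortedAlt =
      faceSum (l.insertionSort (· ≤ ·)) (altSigns SignedKey.sign true) := by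
    refine faceSum_congr fun x hx => ?_
    unfold sortedAlt
    rw [((List.pairwise_insertionSort (· ≤ ·) l).sublist hx).insertionSort_eq]
  rw [h, faceSum_altSigns]
  rfl

/-- The combinatorial core of Fan's lemma. -/
lemma faceSum_sortedAlt {l : List SignedKey}
    (hl : ∀ p ∈ l, ∀ q ∈ l, p.key = q.key → p.sign = q.sign) :
    faceSum l sortedAlt = sortedAlt l + sortedAlt (l.map SignedKey.flip) := by
  rw [faceSum_sortedAlt_eq]
  congr 1
  unfold sortedAlt
  rw [← List.map_insertionSort (r := (· ≤ ·)) (s := (· ≤ ·)) SignedKey.flip l, altSigns_map_flip]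
  · rfl
  · intro p hp q hq
    simp only [SignedKey.le_iff, SignedKey.key_flip, SignedKey.sign_flip]
    have := hl p hp q hq
    refine or_congr Iff.rfl (and_congr_right fun h => ?_)
    simp [this h]

lemma altSigns_key_gap {g : ℝ} (l : List SignedKey) (p : SignedKey) (b : Bool)
    (halt : altSigns SignedKey.sign b (p :: l) ≠ 0) (hsort : (p :: l).Pairwise (· ≤ ·))
    (hg : ∀ q ∈ p :: l, ∀ r ∈ p :: l, q ≤ r → q.sign ≠ r.sign → g ≤ r.key - q.key) :
    ∃ q ∈ p :: l, p.key + l.length * g ≤ q.key ∧ (Even l.length ↔ q.sign = p.sign) := by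
  induction l generalizing p b with
  | nil => exact ⟨p, by simp⟩
  | cons r l ih =>
    have hp : p.sign = b := by by_contra h; simp [altSigns, h] at halt
    have halt' : altSigns SignedKey.sign (!b) (r :: l) ≠ 0 := by
      simpa [altSigns, hp] using halt
    have hr : r.sign = !b := by by_contra h; simp [altSigns, h] at halt'
    obtain ⟨q, hq, hq1, hq2⟩ := ih r (!b) halt' hsort.of_cons
      fun q hq r' hr' => hg q (List.mem_cons_of_mem _ hq) r' (List.mem_cons_of_mem _ hr')
    refine ⟨q, List.mem_cons_of_mem _ hq, ?_, ?_⟩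
    · have := hg p (by simp) r (by simp) (List.rel_of_pairwise_cons hsort (by simp))
        (by simp [hp, hr])
      push_cast [List.length_cons]
      linarith
    · rw [List.length_cons, Nat.even_add_one, hq2, hr, hp]
      rcases b <;> rcases q.sign <;> simp

end Alternating

section Hemispheres

variable {E : Type*} [NormedAddCommGroup E] [InnerProductSpace ℝ E]

/-- Move `x` towards the pole `e`, by the angle `t` if `x` is a unit vector orthogonal to `e`. -/
def pushTo (e : E) (t : ℝ) (x : E) : E := Real.cos t • x + Real.sin t • e

/-- A fine mod 2 chain filling a `k`-dimensional hemisphere with poles `e 0, …, e k`, as a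
functional on cochains; its boundary is the sum of the previous one and its antipode. -/
def hemisphere (N : ℕ) (e : ℕ → E) : ℕ → (List E → ZMod 2) → ZMod 2
  | 0, β => β [e 0]
  | k + 1, β => ∑ t ∈ Finset.range N, hemisphere N e k fun l =>
      let φ (i : ℕ) := pushTo (e (k + 1)) (i * (π / 2 / N))
      prismSum (φ t) (φ (t + 1)) l β + prismSum (φ t) (φ (t + 1)) (l.map Neg.neg) β

lemma hemisphere_add (N : ℕ) (e : ℕ → E) (k : ℕ) (β β' : List E → ZMod 2) :
    hemisphere N e k (fun l => β l + β' l) = hemisphere N e k β + hemisphere N e k β' := by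
  induction k generalizing β β' with
  | zero => rfl
  | succ k ih =>
    simp only [hemisphere, ← Finset.sum_add_distrib, ← ih, prismSum_add]
    refine Finset.sum_congr rfl fun t _ => congrArg _ (funext fun l => ?_)
    ring

lemma hemisphere_sum (N : ℕ) (e : ℕ → E) (k : ℕ) {ι : Type*} (s : Finset ι)
    (β : ι → List E → ZMod 2) :
    hemisphere N e k (fun l => ∑ i ∈ s, β i l) = ∑ i ∈ s, hemisphere N e k (β i) := by
  classical
  induction s using Finset.induction_on with
  | empty => simpa using hemisphere_add N e k (fun _ => 0) (fun _ => 0)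
  | insert a s ha ih => simp only [Finset.sum_insert ha, hemisphere_add, ih]

lemma hemisphere_succ_faceSum_of {N : ℕ} (hN : N ≠ 0) (e : ℕ → E) (k : ℕ)
    (h : ∀ γ : List E → ZMod 2,
      hemisphere N e k (fun l => faceSum l γ + faceSum (l.map Neg.neg) γ) = 0)
    (β : List E → ZMod 2) :
    hemisphere N e (k + 1) (fun l => faceSum l β) =
      hemisphere N e k fun l => β l + β (l.map Neg.neg) := by
  set φ : ℕ → E → E := fun i => pushTo (e (k + 1)) (i * (π / 2 / N)) with hφ
  have hN' : (N : ℝ) ≠ 0 := by exact_mod_cast hN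
  have h0 : ∀ l : List E, l.map (φ 0) = l := fun l => by
    have : φ 0 = id := by funext x; simp [hφ, pushTo]
    simp [this]
  have h1 : ∀ l : List E, (l.map Neg.neg).map (φ N) = l.map (φ N) := fun l => by
    have : ∀ x, φ N x = e (k + 1) := fun x => by
      have h2 : (N : ℝ) * (π / 2 / N) = π / 2 := by field_simp
      simp [hφ, pushTo, h2]
    simp [this]
  have tele : ∀ (l : List E), ∑ t ∈ Finset.range N, (β (l.map (φ (t + 1))) + β (l.map (φ t))) =
      β (l.map (φ N)) + β l := fun l => by
    have := Finset.sum_range_sub (fun t => β (l.map (φ t))) N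
    simpa only [CharTwo.sub_eq_add, h0] using this
  have key : ∀ l : List E, ∑ t ∈ Finset.range N,
      prismSum (φ t) (φ (t + 1)) l (fun x => faceSum x β) = β (l.map (φ N)) + β l +
        faceSum l (fun x => ∑ t ∈ Finset.range N, prismSum (φ t) (φ (t + 1)) x β) := fun l => by
    rw [faceSum_sum, ← tele, ← Finset.sum_add_distrib]
    exact Finset.sum_congr rfl fun t _ => prismSum_faceSum _ _ _ _
  simp only [hemisphere]
  rw [← hemisphere_sum]
  simp only [Finset.sum_add_distrib]
  have := h fun x => ∑ t ∈ Finset.range N, prismSum (φ t) (φ (t + 1)) x β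
  rw [← add_zero (hemisphere N e k fun l => β l + β (l.map Neg.neg)), ← this, ← hemisphere_add]
  congr 1
  funext l
  rw [key, key, h1]
  linear_combination (CharTwo.add_self_eq_zero (β (l.map (φ N))))

lemma hemisphere_symm {N : ℕ} (hN : N ≠ 0) (e : ℕ → E) (k : ℕ) (γ : List E → ZMod 2) :
    hemisphere N e k (fun l => faceSum l γ + faceSum (l.map Neg.neg) γ) = 0 := by
  induction k generalizing γ with
  | zero => simp [hemisphere, faceSum, CharTwo.add_self_eq_zero]
  | succ k ih =>
    have : (fun l => faceSum l γ + faceSum (l.map Neg.neg) γ) =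
        fun l : List E => faceSum l fun x => γ x + γ (x.map Neg.neg) := by
      funext l
      rw [faceSum_add, faceSum_map]
    rw [this, hemisphere_succ_faceSum_of hN e k ih]
    have h0 := hemisphere_add N e k (fun _ => 0) (fun _ => 0)
    have : (fun l : List E => γ l + γ (l.map Neg.neg) +
        (γ (l.map Neg.neg) + γ ((l.map Neg.neg).map Neg.neg))) = fun _ => 0 := by
      funext l
      have h2 : (l.map Neg.neg).map Neg.neg = l := by simp
      rw [h2]
      linear_combination (CharTwo.add_self_eq_zero (γ l + γ (l.map Neg.neg)))
    rw [this]
    simpa using h0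

lemma hemisphere_succ_faceSum {N : ℕ} (hN : N ≠ 0) (e : ℕ → E) (k : ℕ) (β : List E → ZMod 2) :
    hemisphere N e (k + 1) (fun l => faceSum l β) =
      hemisphere N e k fun l => β l + β (l.map Neg.neg) :=
  hemisphere_succ_faceSum_of hN e k (hemisphere_symm hN e k) β

/-- The lists of `k + 1` unit vectors, orthogonal to `e j` for `k < j ≤ n`, and of diameter at
most `ε`. -/
structure IsFine (e : ℕ → E) (n k : ℕ) (ε : ℝ) (l : List E) : Prop where
  length : l.length = k + 1
  norm : ∀ x ∈ l, ‖x‖ = 1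
  orth : ∀ x ∈ l, ∀ j, k < j → j ≤ n → inner ℝ x (e j) = 0
  close : ∀ x ∈ l, ∀ y ∈ l, ‖x - y‖ ≤ ε

lemma IsFine.neg {e : ℕ → E} {n k : ℕ} {ε : ℝ} {l : List E} (h : IsFine e n k ε l) :
    IsFine e n k ε (l.map Neg.neg) where
  length := by simp [h.length]
  norm x hx := by simpa using h.norm (-x) (by simpa using hx)
  orth x hx := by simpa using h.orth (-x) (by simpa using hx)
  close := by
    simp only [List.mem_map, forall_exists_index, and_imp, forall_apply_eq_imp_iff₂]
    intro x hx y hy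
    rw [neg_sub_neg, norm_sub_rev]
    exact h.close x hx y hy

lemma norm_pushTo {e x : E} (he : ‖e‖ = 1) (hx : ‖x‖ = 1) (h : inner ℝ x e = 0) (t : ℝ) :
    ‖pushTo e t x‖ = 1 := by
  have h2 : ‖pushTo e t x‖ ^ 2 = 1 := by
    rw [pushTo, norm_add_sq_real, norm_smul, norm_smul, inner_smul_left, inner_smul_right, h, he,
      hx, Real.norm_eq_abs, Real.norm_eq_abs, mul_one, mul_one, sq_abs, sq_abs]
    simp
  exact (pow_eq_one_iff_of_nonneg (norm_nonneg _) two_ne_zero).1 h2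

lemma norm_pushTo_sub_le {e : E} (he : ‖e‖ = 1) (x y : E) (hx : ‖x‖ = 1) (s t : ℝ) :
    ‖pushTo e s x - pushTo e t y‖ ≤ ‖x - y‖ + 2 * |s - t| := by
  have : pushTo e s x - pushTo e t y =
      Real.cos t • (x - y) + ((Real.cos s - Real.cos t) • x + (Real.sin s - Real.sin t) • e) := by
    simp only [pushTo]
    module
  rw [this]
  refine (norm_add_le _ _).trans (add_le_add ?_ ((norm_add_le _ _).trans ?_))
  · rw [norm_smul, Real.norm_eq_abs]
    exact mul_le_of_le_one_left (norm_nonneg _) (Real.abs_cos_le_one t)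
  · rw [norm_smul, norm_smul, hx, he, Real.norm_eq_abs, Real.norm_eq_abs]
    linarith [Real.abs_cos_sub_cos_le s t, Real.abs_sin_sub_sin_le s t]

lemma hemisphere_congr {N : ℕ} (hN : N ≠ 0) {e : ℕ → E} {n : ℕ} (he : ∀ i ≤ n, ‖e i‖ = 1)
    (horth : ∀ i ≤ n, ∀ j ≤ n, i < j → inner ℝ (e i) (e j) = 0) (k : ℕ) (hk : k ≤ n)
    {β β' : List E → ZMod 2} (h : ∀ l, IsFine e n k (k * (π / N)) l → β l = β' l) :
    hemisphere N e k β = hemisphere N e k β' := by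
  induction k generalizing β β' with
  | zero =>
    refine h _ ⟨rfl, ?_, ?_, ?_⟩
    · simpa using he 0 hk
    · simpa using fun j hj hjn => horth 0 hk j hjn hj
    · simp
  | succ k ih =>
    simp only [hemisphere]
    refine Finset.sum_congr rfl fun t _ => ih (by omega) fun l hl => ?_
    have step : ∀ l, IsFine e n k (k * (π / N)) l →
        prismSum (pushTo (e (k + 1)) (t * (π / 2 / N)))
          (pushTo (e (k + 1)) ((t + 1 : ℕ) * (π / 2 / N))) l β =
        prismSum (pushTo (e (k + 1)) (t * (π / 2 / N)))
          (pushTo (e (k + 1)) ((t + 1 : ℕ) * (π / 2 / N))) l β' := by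
      intro l hl
      refine prismSum_congr fun x hxl hx => h x ?_
      have hx' : ∀ z ∈ x, ∃ v ∈ l, ∃ s : ℝ, (s = t ∨ s = t + 1) ∧
          z = pushTo (e (k + 1)) (s * (π / 2 / N)) v := by
        intro z hz
        obtain ⟨v, hv, hz | hz⟩ := hx z hz
        · exact ⟨v, hv, t, Or.inl rfl, hz⟩
        · exact ⟨v, hv, t + 1, Or.inr rfl, by simpa using hz⟩
      refine ⟨by rw [hxl, hl.length], fun z hz => ?_, fun z hz j hj hjn => ?_, fun z hz w hw => ?_⟩
      · obtain ⟨v, hv, s, -, rfl⟩ := hx' z hz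
        exact norm_pushTo (he _ hk) (hl.norm v hv) (hl.orth v hv _ (by omega) hk) _
      · obtain ⟨v, hv, s, -, rfl⟩ := hx' z hz
        rw [pushTo, inner_add_left, inner_smul_left, inner_smul_left,
          hl.orth v hv j (by omega) hjn, horth (k + 1) hk j hjn hj]
        simp
      · obtain ⟨v, hv, s, hs, rfl⟩ := hx' z hz
        obtain ⟨u, hu, s', hs', rfl⟩ := hx' w hw
        refine (norm_pushTo_sub_le (he _ hk) v u (hl.norm v hv) _ _).trans ?_
        have h1 : |s - s'| ≤ 1 := by
          rw [abs_le]
          rcases hs with rfl | rfl <;> rcases hs' with rfl | rfl <;> constructor <;> linarith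
        have h2 : |s * (π / 2 / N) - s' * (π / 2 / N)| ≤ π / 2 / N := by
          rw [← sub_mul, abs_mul, abs_of_nonneg (by positivity : (0 : ℝ) ≤ π / 2 / N)]
          exact mul_le_of_le_one_left (by positivity) h1
        have h3 := hl.close v hv u hu
        have h4 : 2 * (π / 2 / (N : ℝ)) = π / N := by ring
        push_cast
        linarith
    exact congrArg₂ _ (step l hl) (step _ hl.neg)

/-- A form of Fan's lemma for labellings of a sphere by signed keys. -/
lemma exists_isFine_sortedAlt {e : ℕ → E} {n : ℕ} (he : ∀ i ≤ n, ‖e i‖ = 1)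
    (horth : ∀ i ≤ n, ∀ j ≤ n, i < j → inner ℝ (e i) (e j) = 0) {ε : ℝ} (hε : 0 < ε)
    (lab : E → SignedKey) (hneg : ∀ x, ‖x‖ = 1 → lab (-x) = (lab x).flip)
    (hlab : ∀ x y, ‖x‖ = 1 → ‖y‖ = 1 → ‖x - y‖ ≤ ε →
      (lab x).key = (lab y).key → (lab x).sign = (lab y).sign) :
    ∃ l : List E, l.length = n + 1 ∧ (∀ x ∈ l, ‖x‖ = 1) ∧
      (∀ x ∈ l, ∀ y ∈ l, ‖x - y‖ ≤ ε) ∧ sortedAlt (l.map lab) ≠ 0 := by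
  obtain ⟨N, hN⟩ := exists_nat_gt ((n * π + 1) / ε)
  have hN0 : (0 : ℝ) < N := lt_of_le_of_lt (by positivity) hN
  have hN1 : N ≠ 0 := by rintro rfl; simp at hN0
  have hfine : ∀ k ≤ n, (k : ℝ) * (π / N) ≤ ε := by
    intro k hk
    rw [div_lt_iff₀ hε] at hN
    rw [mul_div_assoc', div_le_iff₀ hN0]
    have : (k : ℝ) * π ≤ n * π := by gcongr
    nlinarith
  set F : List E → ZMod 2 := fun l => sortedAlt (l.map lab) with hF
  have key : ∀ k ≤ n, hemisphere N e k (fun l => F l + F (l.map Neg.neg)) = 1 := by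
    intro k hk
    induction k with
    | zero =>
      have h1 := he 0 hk
      simp only [hemisphere, hF, List.map_cons, List.map_nil, hneg _ h1]
      simp only [sortedAlt, List.insertionSort_cons, List.insertionSort_nil,
        List.orderedInsert_nil, altSigns, SignedKey.sign_flip]
      by_cases h : (lab (e 0)).sign = true <;> simp [h]
    | succ k ih =>
      rw [← ih (by omega), ← hemisphere_succ_faceSum hN1 e k F]
      refine hemisphere_congr hN1 he horth _ hk fun l hl => Eq.symm ?_
      have hmap : (l.map Neg.neg).map lab = (l.map lab).map SignedKey.flip := by
        rw [List.map_map, List.map_map]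
        exact List.map_congr_left fun x hx => hneg x (hl.norm x hx)
      simp only [hF, hmap]
      rw [← faceSum_map lab l sortedAlt, faceSum_sortedAlt]
      simp only [List.mem_map, forall_exists_index, and_imp, forall_apply_eq_imp_iff₂]
      exact fun x hx y hy => hlab x y (hl.norm x hx) (hl.norm y hy)
        ((hl.close x hx y hy).trans (hfine _ hk))
  by_contra! hcon
  have h0 : ∀ l, IsFine e n n (n * (π / N)) l → F l = 0 := fun l hl =>
    hcon l hl.length hl.norm fun x hx y hy => (hl.close x hx y hy).trans (hfine n le_rfl)
  have h1 : hemisphere N e n (fun l => F l + F (l.map Neg.neg)) =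
      hemisphere N e n (fun _ => 0 + 0) :=
    hemisphere_congr hN1 he horth n le_rfl fun l hl => by rw [h0 l hl, h0 _ hl.neg]
  have h2 := hemisphere_add N e n (fun _ => 0) (fun _ => 0)
  rw [key n le_rfl, h2, CharTwo.add_self_eq_zero] at h1
  exact one_ne_zero h1

end Hemispheres

section Geodesic

variable {d : ℕ}

lemma mem_usphere_iff {n : ℕ} (x : Euc (n + 1)) : x ∈ usphere n ↔ ‖x‖ = 1 := by
  change inner ℝ x x = (1 : ℝ) ↔ _
  rw [real_inner_self_eq_norm_sq, pow_eq_one_iff_of_nonneg (norm_nonneg _) two_ne_zero]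

lemma neg_mem_usphere {n : ℕ} {x : Euc (n + 1)} (hx : x ∈ usphere n) : -x ∈ usphere n := by
  rw [mem_usphere_iff] at *
  rwa [norm_neg]

lemma geoDist_nonneg (x y : Euc d) : 0 ≤ geoDist x y := Real.arccos_nonneg _

lemma geoDist_le_pi (x y : Euc d) : geoDist x y ≤ π := Real.arccos_le_pi _

lemma geoDist_neg_left (x y : Euc d) : geoDist (-x) y = π - geoDist x y := by
  rw [geoDist, inner_neg_left, Real.arccos_neg, geoDist]

lemma geoDist_neg_right (x y : Euc d) : geoDist x (-y) = π - geoDist x y := by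
  rw [geoDist, inner_neg_right, Real.arccos_neg, geoDist]

lemma abs_geoDist_sub_le_pi {d' : ℕ} (x y : Euc d) (x' y' : Euc d') :
    |geoDist x y - geoDist x' y'| ≤ π := by
  rw [abs_le]
  constructor <;>
    linarith [geoDist_nonneg x y, geoDist_le_pi x y, geoDist_nonneg x' y', geoDist_le_pi x' y']

lemma geoDist_le_of_norm_sub_le {x y : Euc d} (hx : ‖x‖ = 1) (hy : ‖y‖ = 1) {η : ℝ}
    (h0 : 0 ≤ η) (h1 : η ≤ π) (h : ‖x - y‖ ≤ √(2 - 2 * Real.cos η)) : geoDist x y ≤ η := by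
  have h2 : 0 ≤ 2 - 2 * Real.cos η := by linarith [Real.cos_le_one η]
  have h3 : ‖x - y‖ ^ 2 ≤ 2 - 2 * Real.cos η := by
    rw [← Real.sq_sqrt h2]
    gcongr
  rw [norm_sub_sq_real, hx, hy] at h3
  rw [geoDist, ← Real.arccos_cos h0 h1]
  exact Real.arccos_le_arccos (by linarith)

/-- The bound on the distortion of a relation passes to the antipodally symmetric relation it
generates. -/
lemma abs_geoDist_sub_le_of_symm {d₁ d₂ : ℕ} {R : Set (Euc d₁ × Euc d₂)} {D : ℝ}
    (h : ∀ z ∈ R, ∀ w ∈ R, |geoDist z.1 w.1 - geoDist z.2 w.2| ≤ D) {z w : Euc d₁ × Euc d₂}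
    (hz : z ∈ R ∨ -z ∈ R) (hw : w ∈ R ∨ -w ∈ R) :
    |geoDist z.1 w.1 - geoDist z.2 w.2| ≤ D := by
  rcases hz with hz | hz <;> rcases hw with hw | hw
  · exact h z hz w hw
  · have := h z hz _ hw
    rw [Prod.fst_neg, Prod.snd_neg, geoDist_neg_right, geoDist_neg_right, abs_sub_comm] at this
    convert this using 2
    ring
  · have := h _ hz w hw
    rw [Prod.fst_neg, Prod.snd_neg, geoDist_neg_left, geoDist_neg_left, abs_sub_comm] at this
    convert this using 2
    ring
  · have := h _ hz _ hw
    simp only [Prod.fst_neg, Prod.snd_neg, geoDist_neg_left, geoDist_neg_right] at this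
    convert this using 2
    ring

/-- The point of the circle with angle `t`. -/
def circlePoint (t : ℝ) : Euc 2 := !₂[Real.cos t, Real.sin t]

lemma geoDist_circlePoint (s t : ℝ) :
    geoDist (circlePoint s) (circlePoint t) = Real.arccos (Real.cos (s - t)) := by
  simp [geoDist, circlePoint, PiLp.inner_apply, Fin.sum_univ_two, Real.cos_sub, mul_comm]

lemma circlePoint_add_pi (t : ℝ) : circlePoint (t + π) = -circlePoint t := by
  ext i
  fin_cases i <;> simp [circlePoint]

lemma circlePoint_mem (t : ℝ) : circlePoint t ∈ usphere 1 := by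
  rw [mem_usphere_iff, EuclideanSpace.norm_eq]
  simp [circlePoint, Fin.sum_univ_two]

lemma exists_circlePoint_eq {z : Euc 2} (hz : z ∈ usphere 1) :
    ∃ t : ℝ, -π < t ∧ t ≤ π ∧ circlePoint t = z := by
  have h1 : z 0 * z 0 + z 1 * z 1 = 1 := by
    have h := EuclideanSpace.real_norm_sq_eq z
    rw [(mem_usphere_iff z).1 hz, Fin.sum_univ_two] at h
    linarith
  have h2 : ‖(⟨z 0, z 1⟩ : ℂ)‖ = 1 := by
    rw [← pow_eq_one_iff_of_nonneg (norm_nonneg _) two_ne_zero, ← Complex.normSq_eq_norm_sq,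
      Complex.normSq_mk, h1]
  have h3 := Complex.norm_mul_cos_arg ⟨z 0, z 1⟩
  have h4 := Complex.norm_mul_sin_arg ⟨z 0, z 1⟩
  rw [h2, one_mul] at h3 h4
  refine ⟨Complex.arg ⟨z 0, z 1⟩, Complex.neg_pi_lt_arg _, Complex.arg_le_pi _, ?_⟩
  ext i
  fin_cases i <;> simp [circlePoint, h3, h4]

/-- The point of the circle with angle `θ`, or its antipode, for a signed key `(θ, s)`. -/
def SignedKey.point (p : SignedKey) : Euc 2 :=
  if p.sign = true then circlePoint p.key else -circlePoint p.key

lemma SignedKey.point_flip (p : SignedKey) : p.flip.point = -p.point := by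
  by_cases h : p.sign = true <;> simp [SignedKey.point, h]

lemma exists_point_eq {z : Euc 2} (hz : z ∈ usphere 1) :
    ∃ p : SignedKey, 0 ≤ p.key ∧ p.key < π ∧ p.point = z := by
  obtain ⟨t, h1, h2, rfl⟩ := exists_circlePoint_eq hz
  rcases lt_or_ge t 0 with h | h
  · refine ⟨toLex (t + π, false), ?_, ?_, ?_⟩ <;>
      simp [SignedKey.key, SignedKey.point, SignedKey.sign, circlePoint_add_pi] <;> linarith
  rcases h2.lt_or_eq with h2 | rfl
  · exact ⟨toLex (t, true), h, h2, by simp [SignedKey.key, SignedKey.point, SignedKey.sign]⟩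
  · refine ⟨toLex (0, false), ?_, ?_, ?_⟩
    · simp [SignedKey.key]
    · simpa [SignedKey.key] using Real.pi_pos
    · have := circlePoint_add_pi 0
      rw [zero_add] at this
      simp [SignedKey.key, SignedKey.point, SignedKey.sign, this]

lemma geoDist_point_of_sign_eq {p q : SignedKey} (hp : 0 ≤ p.key) (hp' : p.key < π)
    (hq : 0 ≤ q.key) (hq' : q.key < π) (h : p.sign = q.sign) :
    geoDist p.point q.point = |p.key - q.key| := by
  have h1 : geoDist p.point q.point = geoDist (circlePoint p.key) (circlePoint q.key) := by
    by_cases hs : q.sign = true <;>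
      simp [SignedKey.point, h, hs, geoDist_neg_left, geoDist_neg_right]
  rw [h1, geoDist_circlePoint, ← Real.cos_abs]
  exact Real.arccos_cos (abs_nonneg _) (abs_le.2 ⟨by linarith, by linarith⟩)

lemma geoDist_point_of_sign_ne {p q : SignedKey} (hp : 0 ≤ p.key) (hp' : p.key < π)
    (hq : 0 ≤ q.key) (hq' : q.key < π) (h : p.sign ≠ q.sign) :
    geoDist p.point q.point = π - |p.key - q.key| := by
  have h1 : geoDist p.flip.point q.point = |p.key - q.key| :=
    geoDist_point_of_sign_eq hp hp' hq hq' (by simp [Bool.eq_not_iff.2 h])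
  rw [SignedKey.point_flip, geoDist_neg_left] at h1
  linarith

end Geodesic

section LowerBound

lemma exists_orthonormal_seq {d n : ℕ} (h : n < d) :
    ∃ e : ℕ → Euc d, (∀ i ≤ n, ‖e i‖ = 1) ∧
      ∀ i ≤ n, ∀ j ≤ n, i < j → inner ℝ (e i) (e j) = (0 : ℝ) := by
  refine ⟨fun i => if hi : i < d then EuclideanSpace.single ⟨i, hi⟩ 1 else 0, ?_, ?_⟩
  · intro i hi
    have : i < d := by omega
    simp [this]
  · intro i hi j hj hij
    have h1 : i < d := by omega
    have h2 : j < d := by omega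
    simp [h1, h2, EuclideanSpace.inner_single_left, hij.ne]

lemma le_of_abs_geoDist_sub_le {ℓ n : ℕ} (hn : 2 * ℓ ≤ n) {R : Set (Euc (1 + 1) × Euc (n + 1))}
    (hR : IsCorrespondence (usphere 1) (usphere n) R) {D : ℝ} (hD0 : 0 ≤ D)
    (hD : ∀ z ∈ R, ∀ w ∈ R, |geoDist z.1 w.1 - geoDist z.2 w.2| ≤ D) :
    2 * π * ℓ / (2 * (ℓ : ℝ) + 1) ≤ D := by
  by_contra! hlt
  set r : ℝ := 2 * π * ℓ / (2 * (ℓ : ℝ) + 1) with hr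
  have hr' : r * (2 * ℓ + 1) = 2 * π * ℓ := by rw [hr]; field_simp
  have hrpi : r < π := by
    rw [hr, div_lt_iff₀ (by positivity)]
    nlinarith [Real.pi_pos]
  obtain ⟨hR1, -, hR3⟩ := hR
  have hex : ∀ v : Euc (n + 1), ∃ p : SignedKey,
      ‖v‖ = 1 → (p.point, v) ∈ R ∧ 0 ≤ p.key ∧ p.key < π := by
    intro v
    by_cases hv : ‖v‖ = 1
    · obtain ⟨z, hz, hzR⟩ := hR3 v ((mem_usphere_iff v).2 hv)
      obtain ⟨p, h1, h2, rfl⟩ := exists_point_eq hz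
      exact ⟨p, fun _ => ⟨hzR, h1, h2⟩⟩
    · exact ⟨toLex (0, true), fun h => absurd h hv⟩
  choose g hg using hex
  classical
  let lab : Euc (n + 1) → SignedKey := fun v =>
    if WellOrderingRel v (-v) then g v else (g (-v)).flip
  have flip_flip : ∀ p : SignedKey, p.flip.flip = p := fun p => by
    simp [SignedKey.flip, SignedKey.key, SignedKey.sign]
  have hneg : ∀ v, ‖v‖ = 1 → lab (-v) = (lab v).flip := by
    intro v hv
    have hne : v ≠ -v := fun h => by
      have h2 : (2 : ℝ) • v = 0 := by rw [two_smul, ← eq_neg_iff_add_eq_zero, ← h]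
      rw [(smul_eq_zero.1 h2).resolve_left two_ne_zero, norm_zero] at hv
      exact zero_ne_one hv
    by_cases h : WellOrderingRel v (-v)
    · have h' : ¬ WellOrderingRel (-v) v := asymm_of _ h
      simp [lab, h, h']
    · have h' : WellOrderingRel (-v) v := by
        rcases trichotomous_of WellOrderingRel v (-v) with h1 | h1 | h1
        exacts [absurd h1 h, absurd h1 hne, h1]
      simp [lab, h, h', flip_flip]
  have hmem : ∀ v, ‖v‖ = 1 → (((lab v).point, v) ∈ R ∨ -((lab v).point, v) ∈ R) ∧
      0 ≤ (lab v).key ∧ (lab v).key < π := by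
    intro v hv
    by_cases h : WellOrderingRel v (-v)
    · simp only [lab, h, if_true]
      exact ⟨Or.inl (hg v hv).1, (hg v hv).2⟩
    · have := hg (-v) (by rwa [norm_neg])
      simp only [lab, h, if_false, SignedKey.key_flip, SignedKey.point_flip]
      refine ⟨Or.inr ?_, this.2⟩
      simpa using this.1
  set η : ℝ := (r - D) / 2 with hη
  have hη0 : 0 < η := by rw [hη]; linarith
  have hηpi : η < π := by rw [hη]; linarith [Real.pi_pos]
  have hcos : Real.cos η < 1 := by
    rw [← Real.cos_zero]
    exact Real.cos_lt_cos_of_nonneg_of_le_pi le_rfl hηpi.le hη0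
  have hdist : ∀ v w, ‖v‖ = 1 → ‖w‖ = 1 → ‖v - w‖ ≤ √(2 - 2 * Real.cos η) →
      geoDist (lab v).point (lab w).point ≤ D + η := by
    intro v w hv hw hvw
    have h1 := geoDist_le_of_norm_sub_le hv hw hη0.le hηpi.le hvw
    have h2 := (abs_le.1 (abs_geoDist_sub_le_of_symm hD (hmem v hv).1 (hmem w hw).1)).2
    simp only at h2
    linarith
  obtain ⟨e, he, horth⟩ := exists_orthonormal_seq (d := n + 1) (n := 2 * ℓ) (by omega)
  obtain ⟨l, hlen, hnorm, hclose, hne⟩ := exists_isFine_sortedAlt he horth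
    (Real.sqrt_pos.2 (by linarith : 0 < 2 - 2 * Real.cos η)) lab hneg <| by
      intro v w hv hw hvw hkey
      by_contra hs
      have h1 := hdist v w hv hw hvw
      rw [geoDist_point_of_sign_ne (hmem v hv).2.1 (hmem v hv).2.2 (hmem w hw).2.1
        (hmem w hw).2.2 hs, hkey, sub_self, abs_zero] at h1
      linarith
  have hL : ∀ p ∈ (l.map lab).insertionSort (· ≤ ·), ∀ q ∈ (l.map lab).insertionSort (· ≤ ·),
      0 ≤ p.key ∧ p.key < π ∧ geoDist p.point q.point ≤ D + η := by
    simp only [List.mem_insertionSort, List.mem_map, forall_exists_index, and_imp,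
      forall_apply_eq_imp_iff₂]
    exact fun v hv w hw => ⟨(hmem v (hnorm v hv)).2.1, (hmem v (hnorm v hv)).2.2,
      hdist v w (hnorm v hv) (hnorm w hw) (hclose v hv w hw)⟩
  have hLsort := List.pairwise_insertionSort (· ≤ ·) (l.map lab)
  have hLlen : ((l.map lab).insertionSort (· ≤ ·)).length = 2 * ℓ + 1 := by
    rw [List.length_insertionSort, List.length_map, hlen]
  unfold sortedAlt at hne
  generalize (l.map lab).insertionSort (· ≤ ·) = L at *
  obtain - | ⟨p, L⟩ := L
  · simp at hLlen
  have hLlen' : L.length = 2 * ℓ := by simpa using hLlen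
  obtain ⟨q, hq, hq1, hq2⟩ := altSigns_key_gap (g := π - (D + η)) L p true hne hLsort <| by
    intro a ha b hb hab hs
    have h1 := (hL a ha b hb).2.2
    rw [geoDist_point_of_sign_ne (hL a ha b hb).1 (hL a ha b hb).2.1 (hL b hb a ha).1
      (hL b hb a ha).2.1 hs, abs_sub_comm, abs_of_nonneg
      (sub_nonneg.2 (SignedKey.key_le hab))] at h1
    linarith
  rw [hLlen'] at hq1 hq2
  have hp : p ∈ p :: L := by simp
  have h1 := (hL q hq p hp).2.2
  rw [geoDist_point_of_sign_eq (hL q hq p hp).1 (hL q hq p hp).2.1 (hL p hp q hq).1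
    (hL p hp q hq).2.1 (hq2.1 (even_two_mul ℓ))] at h1
  have h2 := le_abs_self (q.key - p.key)
  push_cast at hq1
  have h3 : D + η < r := by rw [hη]; linarith
  nlinarith [(Nat.cast_nonneg ℓ : (0 : ℝ) ≤ ℓ)]

end LowerBound

section UpperBound

/-- Two vectors of nonnegative sum with the same largest coordinate form an angle whose cosine
is at least `-(m - 1) / (m + 1)`. -/
lemma sum_mul_add_sum_sq_nonneg {m : ℕ} (u v : Fin m → ℝ) (k : Fin m) (hu : ∀ i, u i ≤ u k)
    (hv : ∀ i, v i ≤ v k) (hu0 : 0 ≤ ∑ i, u i) (hv0 : 0 ≤ ∑ i, v i) :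
    0 ≤ 2 * (m + 1) * ∑ i, u i * v i + (m - 1) * (∑ i, u i ^ 2 + ∑ i, v i ^ 2) := by
  obtain ⟨p, hp⟩ : ∃ p : Fin m → ℝ, p = fun i => u k - u i := ⟨_, rfl⟩
  obtain ⟨q, hq⟩ : ∃ q : Fin m → ℝ, q = fun i => v k - v i := ⟨_, rfl⟩
  have hup : ∀ i, u i = u k - p i := fun i => by simp [hp]
  have hvq : ∀ i, v i = v k - q i := fun i => by simp [hq]
  have hpq0 : 0 ≤ ∑ i, p i * q i := Finset.sum_nonneg fun i _ => by
    rw [hp, hq]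
    exact mul_nonneg (sub_nonneg.2 (hu i)) (sub_nonneg.2 (hv i))
  have hm : (0 : ℝ) < m := by exact_mod_cast k.pos
  have hcs : (∑ i, p i + ∑ i, q i) ^ 2 ≤
      (m - 1) * (∑ i, p i ^ 2 + 2 * ∑ i, p i * q i + ∑ i, q i ^ 2) := by
    have h1 := sq_sum_le_card_mul_sum_sq (s := Finset.univ.erase k) (f := fun i => p i + q i)
    rw [Finset.card_erase_of_mem (Finset.mem_univ k), Finset.card_univ, Fintype.card_fin,
      Nat.cast_sub k.pos, Nat.cast_one, Finset.sum_erase _ (by simp [hp, hq]),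
      Finset.sum_erase _ (by simp [hp, hq])] at h1
    have h2 : ∑ i, (p i + q i) ^ 2 = ∑ i, p i ^ 2 + 2 * ∑ i, p i * q i + ∑ i, q i ^ 2 := by
      rw [Finset.mul_sum, ← Finset.sum_add_distrib, ← Finset.sum_add_distrib]
      exact Finset.sum_congr rfl fun i _ => by ring
    rwa [h2, Finset.sum_add_distrib] at h1
  have expand : ∀ (a b : ℝ) (f g : Fin m → ℝ), ∑ i, (a - f i) * (b - g i) =
      m * (a * b) - a * ∑ i, g i - b * ∑ i, f i + ∑ i, f i * g i := by
    intro a b f g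
    have : ∀ i, (a - f i) * (b - g i) = a * b - a * g i - b * f i + f i * g i := fun i => by ring
    simp only [this, Finset.sum_add_distrib, Finset.sum_sub_distrib, ← Finset.mul_sum]
    simp
    ring
  have e1 : ∑ i, u i * v i = m * (u k * v k) - u k * ∑ i, q i - v k * ∑ i, p i +
      ∑ i, p i * q i := by
    rw [← expand]
    exact Finset.sum_congr rfl fun i _ => by rw [← hup, ← hvq]
  have e2 : ∑ i, u i ^ 2 = m * (u k * u k) - u k * ∑ i, p i - u k * ∑ i, p i +
      ∑ i, p i ^ 2 := by
    simp only [sq]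
    rw [← expand]
    exact Finset.sum_congr rfl fun i _ => by rw [← hup]
  have e3 : ∑ i, v i ^ 2 = m * (v k * v k) - v k * ∑ i, q i - v k * ∑ i, q i +
      ∑ i, q i ^ 2 := by
    simp only [sq]
    rw [← expand]
    exact Finset.sum_congr rfl fun i _ => by rw [← hvq]
  have e4 : ∑ i, u i = m * u k - ∑ i, p i := by simp [hp]
  have e5 : ∑ i, v i = m * v k - ∑ i, q i := by simp [hq]
  rw [e4] at hu0
  rw [e5] at hv0
  rw [e1, e2, e3]
  have hm1 : (0 : ℝ) ≤ m - 1 := by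
    have : (1 : ℝ) ≤ m := by exact_mod_cast k.pos
    linarith
  generalize ∑ i, p i * q i = X at *
  generalize ∑ i, p i ^ 2 = Y at *
  generalize ∑ i, q i ^ 2 = Z at *
  generalize ∑ i, p i = P at *
  generalize ∑ i, q i = Q at *
  have h1 := mul_nonneg hu0 hv0
  have h2 : 0 ≤ (m : ℝ) * (2 * (m + 1) * (m * (u k * v k) - u k * Q - v k * P + X) +
      (m - 1) * (m * (u k * u k) - u k * P - u k * P + Y +
        (m * (v k * v k) - v k * Q - v k * Q + Z))) := by
    have h3 := mul_nonneg hm1 (sq_nonneg (m * u k - P))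
    have h4 := mul_nonneg hm1 (sq_nonneg (m * v k - Q))
    have h5 := mul_le_mul_of_nonneg_left hcs hm.le
    have h6 := mul_nonneg hm.le hpq0
    have h7 := mul_nonneg hm.le h1
    nlinarith [sq_nonneg (P - Q)]
  exact nonneg_of_mul_nonneg_right h2 hm

lemma neg_mul_le_sum_mul {m : ℕ} (u v : Fin m → ℝ) (k : Fin m) (hu : ∀ i, u i ≤ u k)
    (hv : ∀ i, v i ≤ v k) (hu0 : 0 ≤ ∑ i, u i) (hv0 : 0 ≤ ∑ i, v i) {A B : ℝ} (hA : 0 ≤ A)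
    (hB : 0 ≤ B) (huA : ∑ i, u i ^ 2 = A ^ 2) (hvB : ∑ i, v i ^ 2 = B ^ 2) :
    -((m - 1) * (A * B)) ≤ (m + 1) * ∑ i, u i * v i := by
  have hzero : ∀ f : Fin m → ℝ, ∑ i, f i ^ 2 = 0 → ∀ i, f i = 0 := fun f hf i => by
    have := (Finset.sum_eq_zero_iff_of_nonneg fun i _ => sq_nonneg (f i)).1 hf i
      (Finset.mem_univ i)
    simpa using this
  rcases hA.eq_or_lt with rfl | hA
  · have := hzero u (by simpa using huA)
    simp [this]
  rcases hB.eq_or_lt with rfl | hB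
  · have := hzero v (by simpa using hvB)
    simp [this]
  have h := sum_mul_add_sum_sq_nonneg (fun i => B * u i) (fun i => A * v i) k
    (fun i => mul_le_mul_of_nonneg_left (hu i) hB.le)
    (fun i => mul_le_mul_of_nonneg_left (hv i) hA.le)
    (by rw [← Finset.mul_sum]; positivity) (by rw [← Finset.mul_sum]; positivity)
  have e : ∑ i, B * u i * (A * v i) = A * B * ∑ i, u i * v i := by
    rw [Finset.mul_sum]
    exact Finset.sum_congr rfl fun i _ => by ring
  simp only [mul_pow, ← Finset.mul_sum, huA, hvB, e] at h
  have hAB := mul_pos hA hB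
  have h2 : 0 ≤ (A * B) * ((m + 1) * ∑ i, u i * v i + (m - 1) * (A * B)) := by linarith
  linarith [nonneg_of_mul_nonneg_right h2 hAB]

lemma mul_one_sub_cos_div_le {ℓ : ℕ} (hℓ : 1 ≤ ℓ) {x : ℝ} (h0 : 0 ≤ x) (hpi : x ≤ π) :
    (2 * ℓ + 1 + 1) * (1 - Real.cos (x / (2 * ℓ + 1))) ≤ 1 - Real.cos x := by
  set m : ℝ := 2 * ℓ + 1 with hm
  have hm0 : 0 < m := by positivity
  obtain ⟨y, rfl⟩ : ∃ y, x = 2 * (m * y) := ⟨x / (2 * m), by field_simp⟩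
  have hy0 : 0 ≤ y := nonneg_of_mul_nonneg_right (by linarith : 0 ≤ m * y) hm0
  have e : 2 * (m * y) / m = 2 * y := by field_simp
  rw [e, Real.cos_two_mul, Real.cos_two_mul, Real.cos_sq', Real.cos_sq']
  suffices (m + 1) * Real.sin y ^ 2 ≤ Real.sin (m * y) ^ 2 by linarith
  have hmy : m * y ≤ π / 2 := by linarith
  have hm3 : 3 ≤ m := by
    have : (1 : ℝ) ≤ ℓ := by exact_mod_cast hℓ
    linarith
  have hs0 : 0 ≤ Real.sin y :=
    Real.sin_nonneg_of_nonneg_of_le_pi hy0 (by nlinarith [Real.pi_pos])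
  rcases hℓ.eq_or_lt with rfl | hℓ
  · have hm' : m = 3 := by rw [hm]; norm_num
    rw [hm'] at hmy ⊢
    have hs : Real.sin y ≤ 1 / 2 := by
      rw [← Real.sin_pi_div_six]
      exact Real.sin_le_sin_of_le_of_le_pi_div_two (by linarith [Real.pi_pos])
        (by linarith [Real.pi_pos]) (by linarith)
    have h3 : 2 * Real.sin y ≤ Real.sin (3 * y) := by
      rw [Real.sin_three_mul]
      have : Real.sin y ^ 2 ≤ 1 / 4 := by nlinarith
      nlinarith
    nlinarith
  · have hm5 : 5 ≤ m := by
      have : (2 : ℝ) ≤ ℓ := by exact_mod_cast hℓ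
      linarith
    have h1 := Real.mul_le_sin (by positivity : 0 ≤ m * y) hmy
    have h2 : 2 / π * m * Real.sin y ≤ Real.sin (m * y) := by
      refine le_trans ?_ h1
      rw [mul_assoc]
      gcongr
      exact Real.sin_le hy0
    have h3 : m + 1 ≤ (2 / π * m) ^ 2 := by
      rw [div_mul_eq_mul_div, div_pow, le_div_iff₀ (by positivity)]
      have : π ^ 2 ≤ 10 := by nlinarith [Real.pi_lt_d2, Real.pi_pos]
      nlinarith
    calc (m + 1) * Real.sin y ^ 2 ≤ (2 / π * m) ^ 2 * Real.sin y ^ 2 := by gcongr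
      _ = (2 / π * m * Real.sin y) ^ 2 := by ring
      _ ≤ _ := by gcongr

lemma arccos_cos_eq_min {x : ℝ} (hx : |x| ≤ 2 * π) :
    Real.arccos (Real.cos x) = min |x| (2 * π - |x|) := by
  rw [← Real.cos_abs]
  rcases le_total |x| π with h | h
  · rw [Real.arccos_cos (abs_nonneg x) h, min_eq_left (by linarith)]
  · rw [← Real.cos_two_pi_sub, Real.arccos_cos (by linarith) (by linarith),
      min_eq_right (by linarith)]

/-- Half of an optimal correspondence between the circle and an odd-dimensional sphere; the other
half is its antipode. -/
def spiralRel (ℓ : ℕ) : Set (Euc (1 + 1) × Euc (2 * ℓ + 1 + 1)) :=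
  {z | z.2 ∈ usphere (2 * ℓ + 1) ∧ 0 ≤ ∑ i : Fin (2 * ℓ + 1), z.2 i.succ ∧
    ∃ k : Fin (2 * ℓ + 1), (∀ i : Fin (2 * ℓ + 1), z.2 i.succ ≤ z.2 k.succ) ∧
      z.1 = circlePoint ((2 * k * π + Real.arcsin (z.2 0)) / (2 * ℓ + 1))}

variable {ℓ : ℕ}

lemma sum_succ_sq {n : ℕ} {y : Euc (n + 1)} (hy : y ∈ usphere n) :
    ∑ i : Fin n, y i.succ ^ 2 = Real.cos (Real.arcsin (y 0)) ^ 2 ∧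
      Real.sin (Real.arcsin (y 0)) = y 0 := by
  have h := EuclideanSpace.real_norm_sq_eq y
  rw [(mem_usphere_iff y).1 hy, Fin.sum_univ_succ] at h
  have h1 : 0 ≤ ∑ i : Fin n, y i.succ ^ 2 := Finset.sum_nonneg fun i _ => sq_nonneg _
  have h2 : |y 0| ≤ 1 := by rw [← sq_le_one_iff_abs_le_one]; linarith
  have h3 := Real.sin_arcsin (abs_le.1 h2).1 (abs_le.1 h2).2
  refine ⟨?_, h3⟩
  rw [Real.cos_sq', h3]
  linarith

lemma inner_eq_sum_succ {n : ℕ} (y y' : Euc (n + 1)) :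
    inner ℝ y y' = y 0 * y' 0 + ∑ i : Fin n, y i.succ * y' i.succ := by
  rw [PiLp.inner_apply, Fin.sum_univ_succ]
  simp [mul_comm]

lemma abs_arcsin_sub_le_geoDist {n : ℕ} {y y' : Euc (n + 1)} (hy : y ∈ usphere n)
    (hy' : y' ∈ usphere n) : |Real.arcsin (y 0) - Real.arcsin (y' 0)| ≤ geoDist y y' := by
  obtain ⟨h1, h2⟩ := sum_succ_sq hy
  obtain ⟨h1', h2'⟩ := sum_succ_sq hy'
  have hcs := Finset.sum_mul_sq_le_sq_mul_sq Finset.univ (fun i : Fin n => y i.succ)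
    fun i => y' i.succ
  rw [h1, h1', ← mul_pow] at hcs
  have h3 := abs_le_of_sq_le_sq hcs
    (mul_nonneg (Real.cos_arcsin_nonneg _) (Real.cos_arcsin_nonneg _))
  have h4 : inner ℝ y y' ≤ Real.cos |Real.arcsin (y 0) - Real.arcsin (y' 0)| := by
    rw [inner_eq_sum_succ, Real.cos_abs, Real.cos_sub, h2, h2']
    linarith [le_of_abs_le h3]
  have h5 : |Real.arcsin (y 0) - Real.arcsin (y' 0)| ≤ π := by
    rw [abs_le]
    constructor <;> linarith [Real.neg_pi_div_two_le_arcsin (y 0), Real.arcsin_le_pi_div_two (y 0),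
      Real.neg_pi_div_two_le_arcsin (y' 0), Real.arcsin_le_pi_div_two (y' 0)]
  rw [geoDist, ← Real.arccos_cos (abs_nonneg _) h5]
  exact Real.arccos_le_arccos h4

lemma geoDist_le_of_same_cell (hℓ : 1 ≤ ℓ) {y y' : Euc (2 * ℓ + 1 + 1)}
    (hy : y ∈ usphere (2 * ℓ + 1)) (hy' : y' ∈ usphere (2 * ℓ + 1))
    (h0 : 0 ≤ ∑ i : Fin (2 * ℓ + 1), y i.succ) (h0' : 0 ≤ ∑ i : Fin (2 * ℓ + 1), y' i.succ)
    (k : Fin (2 * ℓ + 1)) (hk : ∀ i : Fin (2 * ℓ + 1), y i.succ ≤ y k.succ)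
    (hk' : ∀ i : Fin (2 * ℓ + 1), y' i.succ ≤ y' k.succ) :
    geoDist y y' ≤ π - (π - |Real.arcsin (y 0) - Real.arcsin (y' 0)|) / (2 * ℓ + 1) := by
  obtain ⟨h1, h2⟩ := sum_succ_sq hy
  obtain ⟨h1', h2'⟩ := sum_succ_sq hy'
  have hcell := neg_mul_le_sum_mul (fun i : Fin (2 * ℓ + 1) => y i.succ) (fun i => y' i.succ) k
    hk hk' h0 h0' (Real.cos_arcsin_nonneg _) (Real.cos_arcsin_nonneg _) h1 h1'
  push_cast at hcell
  have hin := inner_eq_sum_succ y y'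
  set S := ∑ i : Fin (2 * ℓ + 1), y i.succ * y' i.succ
  have hbd := Real.neg_pi_div_two_le_arcsin (y 0)
  have hbd' := Real.neg_pi_div_two_le_arcsin (y' 0)
  have hbd2 := Real.arcsin_le_pi_div_two (y 0)
  have hbd2' := Real.arcsin_le_pi_div_two (y' 0)
  rw [← h2, ← h2'] at hin
  set φ := Real.arcsin (y 0)
  set φ' := Real.arcsin (y' 0)
  have hδ : |φ - φ'| ≤ π := by rw [abs_le]; constructor <;> linarith
  have htrig := mul_one_sub_cos_div_le hℓ (sub_nonneg.2 hδ) (sub_le_self π (abs_nonneg _))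
  rw [Real.cos_pi_sub, Real.cos_abs, Real.cos_sub] at htrig
  have hsum := Real.cos_le_one (φ + φ')
  rw [Real.cos_add] at hsum
  set ε := (π - |φ - φ'|) / (2 * (ℓ : ℝ) + 1) with hε
  have hε0 : 0 ≤ ε := div_nonneg (sub_nonneg.2 hδ) (by positivity)
  have hm1 : (1 : ℝ) ≤ 2 * ℓ + 1 := by
    have : (0 : ℝ) ≤ ℓ := Nat.cast_nonneg ℓ
    linarith
  have hεpi : ε ≤ π :=
    (div_le_self (sub_nonneg.2 hδ) hm1).trans (sub_le_self π (abs_nonneg _))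
  rw [geoDist, ← Real.arccos_cos (sub_nonneg.2 hεpi) (sub_le_self π hε0), Real.cos_pi_sub]
  refine Real.arccos_le_arccos ?_
  rw [hin]
  have hm : (0 : ℝ) < 2 * ℓ + 1 + 1 := by positivity
  refine le_of_mul_le_mul_left ?_ hm
  nlinarith [mul_le_mul_of_nonneg_left hsum (zero_le_one.trans hm1)]

lemma spiralRel_distortion (hℓ : 1 ≤ ℓ) : ∀ z ∈ spiralRel ℓ, ∀ w ∈ spiralRel ℓ,
    |geoDist z.1 w.1 - geoDist z.2 w.2| ≤ 2 * π * ℓ / (2 * (ℓ : ℝ) + 1) := by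
  rintro ⟨x, y⟩ ⟨hy, h0, k, hk, hx⟩ ⟨x', y'⟩ ⟨hy', h0', k', hk', hx'⟩
  dsimp only at *
  subst hx hx'
  have hlow := abs_arcsin_sub_le_geoDist hy hy'
  have hpi := Real.pi_pos
  have hdpi := geoDist_le_pi y y'
  have hℓ' : (1 : ℝ) ≤ ℓ := by exact_mod_cast hℓ
  have hm0 : (0 : ℝ) < 2 * ℓ + 1 := by positivity
  have hr : 2 * π * ℓ / (2 * (ℓ : ℝ) + 1) = π - π / (2 * ℓ + 1) := by field_simp; ring
  have hπm : π / (2 * ℓ + 1) ≤ π / 3 := by gcongr; linarith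
  have hδ := hlow.trans hdpi
  have hδm : |Real.arcsin (y 0) - Real.arcsin (y' 0)| / (2 * ℓ + 1) ≤ π / (2 * ℓ + 1) := by gcongr
  have hδm0 : 0 ≤ |Real.arcsin (y 0) - Real.arcsin (y' 0)| / (2 * (ℓ : ℝ) + 1) := by positivity
  rw [geoDist_circlePoint, ← sub_div, hr]
  have hx : (2 * k * π + Real.arcsin (y 0) - (2 * k' * π + Real.arcsin (y' 0))) =
      2 * π * ((k : ℝ) - k') + (Real.arcsin (y 0) - Real.arcsin (y' 0)) := by ring
  rw [hx]
  by_cases hkk : k = k'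
  · subst hkk
    have hsame := geoDist_le_of_same_cell hℓ hy hy' h0 h0' k hk hk'
    rw [sub_self, mul_zero, zero_add]
    have habs : |(Real.arcsin (y 0) - Real.arcsin (y' 0)) / (2 * (ℓ : ℝ) + 1)| =
        |Real.arcsin (y 0) - Real.arcsin (y' 0)| / (2 * ℓ + 1) := by
      rw [abs_div, abs_of_pos hm0]
    rw [arccos_cos_eq_min (by rw [habs]; linarith), habs, min_eq_left (by linarith)]
    rw [sub_div] at hsame
    rw [abs_le]
    constructor <;> linarith [geoDist_nonneg y y']
  · obtain ⟨j, hj⟩ : ∃ j : ℕ, j = ((k : ℤ) - k').natAbs := ⟨_, rfl⟩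
    have hj1 : 1 ≤ j := by
      have : (k : ℕ) ≠ k' := fun h => hkk (Fin.ext h)
      omega
    have hj2 : j ≤ 2 * ℓ := by omega
    have hjabs : |(k : ℝ) - k'| = j := by
      rw [hj, Nat.cast_natAbs]
      push_cast
      rfl
    set δ := Real.arcsin (y 0) - Real.arcsin (y' 0)
    set X := (2 * π * ((k : ℝ) - k') + δ) / (2 * ℓ + 1) with hX
    have habs : |X| = |2 * π * ((k : ℝ) - k') + δ| / (2 * ℓ + 1) := by
      rw [hX, abs_div, abs_of_pos hm0]
    have habs2 : |2 * π * ((k : ℝ) - k')| = 2 * π * j := by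
      rw [abs_mul, hjabs, abs_of_pos (by positivity)]
    have hup : |X| ≤ (2 * π * j + |δ|) / (2 * ℓ + 1) := by
      rw [habs, ← habs2]
      gcongr
      exact abs_add_le _ _
    have hdown : (2 * π * j - |δ|) / (2 * ℓ + 1) ≤ |X| := by
      rw [habs, ← habs2]
      gcongr
      have := abs_sub_abs_le_abs_sub (2 * π * ((k : ℝ) - k')) (-δ)
      rwa [abs_neg, sub_neg_eq_add] at this
    have hj1' : (1 : ℝ) ≤ j := by exact_mod_cast hj1
    have hj2' : (j : ℝ) ≤ 2 * ℓ := by exact_mod_cast hj2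
    have hd1 : π / (2 * ℓ + 1) ≤ |X| := le_trans (by gcongr; nlinarith) hdown
    have hu1 : |X| ≤ 2 * π - π / (2 * ℓ + 1) := by
      refine hup.trans ?_
      rw [div_le_iff₀ hm0, sub_mul, div_mul_cancel₀ _ hm0.ne']
      nlinarith
    have hπm0 : 0 ≤ π / (2 * (ℓ : ℝ) + 1) := by positivity
    rw [arccos_cos_eq_min (by linarith), abs_le]
    constructor
    · have : π / (2 * ℓ + 1) ≤ min |X| (2 * π - |X|) := le_min hd1 (by linarith)
      linarith
    · have hmin : min |X| (2 * π - |X|) ≤ π - π / (2 * ℓ + 1) + |δ| / (2 * ℓ + 1) := by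
        have e : π - π / (2 * (ℓ : ℝ) + 1) + |δ| / (2 * ℓ + 1) =
            (2 * π * ℓ + |δ|) / (2 * ℓ + 1) := by
          rw [← hr, add_div]
        rw [e]
        rcases Nat.lt_or_ge ℓ j with h | h
        · have h' : (ℓ : ℝ) + 1 ≤ j := by exact_mod_cast h
          refine (min_le_right _ _).trans ((sub_le_sub_left hdown _).trans ?_)
          rw [sub_le_iff_le_add, ← add_div, le_div_iff₀ hm0]
          nlinarith
        · have h' : (j : ℝ) ≤ ℓ := by exact_mod_cast h
          refine (min_le_left _ _).trans (hup.trans ?_)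
          gcongr
      have hδm1 : |δ| / (2 * (ℓ : ℝ) + 1) ≤ |δ| := div_le_self (abs_nonneg _) (by linarith)
      linarith

lemma exists_spiralRel_circlePoint_int (p : ℤ) {φ : ℝ} (h1 : -(π / 2) ≤ φ) (h2 : φ ≤ π / 2) :
    ∃ y, (circlePoint ((2 * p * π + φ) / (2 * ℓ + 1)), y) ∈ spiralRel ℓ := by
  have hc : 0 ≤ Real.cos φ := Real.cos_nonneg_of_mem_Icc ⟨h1, h2⟩
  have hmZ : (0 : ℤ) < 2 * ℓ + 1 := by positivity
  have hm0 : (2 * (ℓ : ℝ) + 1) ≠ 0 := by positivity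
  obtain ⟨k, hk⟩ : ∃ k : Fin (2 * ℓ + 1), (k : ℤ) = p % (2 * ℓ + 1) := by
    have h3 := Int.emod_nonneg p hmZ.ne'
    have h4 := Int.emod_lt_of_pos p hmZ
    exact ⟨⟨(p % (2 * ℓ + 1)).toNat, by omega⟩, by simp [h3]⟩
  have hp : (p : ℝ) = k + (2 * ℓ + 1) * (p / (2 * ℓ + 1) : ℤ) := by
    have := Int.emod_add_mul_ediv p (2 * ℓ + 1)
    rw [← hk] at this
    exact_mod_cast this.symm
  let y : Euc (2 * ℓ + 1 + 1) :=
    WithLp.toLp 2 (Fin.cons (Real.sin φ) (Pi.single k (Real.cos φ)))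
  have hy0 : y 0 = Real.sin φ := rfl
  have hys : ∀ i : Fin (2 * ℓ + 1), y i.succ = (Pi.single k (Real.cos φ) : _ → ℝ) i :=
    fun i => rfl
  refine ⟨y, ?_, ?_, k, ?_, ?_⟩
  · rw [mem_usphere_iff, ← pow_eq_one_iff_of_nonneg (norm_nonneg _) two_ne_zero,
      EuclideanSpace.real_norm_sq_eq, Fin.sum_univ_succ]
    simp [hy0, hys, Pi.single_apply, ite_pow]
  · simpa [hys] using hc
  · intro i
    by_cases h : i = k
    · rw [h]
    · simpa [hys, h] using hc
  · simp only [hy0, Real.arcsin_sin h1 h2]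
    have e : (2 * p * π + φ) / (2 * ℓ + 1) =
        (2 * k * π + φ) / (2 * ℓ + 1) + (p / (2 * ℓ + 1) : ℤ) * (2 * π) := by
      rw [hp]
      field_simp
      ring
    rw [e, circlePoint, circlePoint, Real.cos_add_int_mul_two_pi, Real.sin_add_int_mul_two_pi]

/-- An optimal correspondence between the circle and an odd-dimensional sphere. -/
lemma isCorrespondence_spiralRel (ℓ : ℕ) :
    IsCorrespondence (usphere 1) (usphere (2 * ℓ + 1)) {z | z ∈ spiralRel ℓ ∨ -z ∈ spiralRel ℓ} := by
  have hsub : ∀ z ∈ spiralRel ℓ, z.1 ∈ usphere 1 ∧ z.2 ∈ usphere (2 * ℓ + 1) := by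
    rintro ⟨x, y⟩ ⟨hy, -, k, -, hx⟩
    dsimp only at hx
    exact ⟨hx ▸ circlePoint_mem _, hy⟩
  have hsub' : ∀ z, (z ∈ spiralRel ℓ ∨ -z ∈ spiralRel ℓ) →
      z.1 ∈ usphere 1 ∧ z.2 ∈ usphere (2 * ℓ + 1) := by
    rintro z (hz | hz)
    · exact hsub z hz
    · have := hsub _ hz
      exact ⟨by simpa using neg_mem_usphere this.1, by simpa using neg_mem_usphere this.2⟩
  refine ⟨hsub', fun x hx => ?_, fun y hy => ?_⟩
  · suffices ∃ y, (x, y) ∈ spiralRel ℓ ∨ -(x, y) ∈ spiralRel ℓ by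
      obtain ⟨y, hy⟩ := this
      exact ⟨y, (hsub' _ hy).2, hy⟩
    obtain ⟨t, -, -, rfl⟩ := exists_circlePoint_eq hx
    have hm0 : (2 * (ℓ : ℝ) + 1) ≠ 0 := by positivity
    set q : ℤ := round ((2 * ℓ + 1) * t / π) with hq
    set φ : ℝ := (2 * ℓ + 1) * t - q * π with hφ
    have hround := abs_le.1 (abs_sub_round ((2 * ℓ + 1) * t / π))
    have hmul : (2 * ℓ + 1) * t / π * π = (2 * ℓ + 1) * t := div_mul_cancel₀ _ Real.pi_ne_zero
    have h1 : -(π / 2) ≤ φ := by nlinarith [Real.pi_pos]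
    have h2 : φ ≤ π / 2 := by nlinarith [Real.pi_pos]
    rcases Int.even_or_odd' q with ⟨p, hp | hp⟩
    · obtain ⟨y, hy⟩ := exists_spiralRel_circlePoint_int (ℓ := ℓ) p h1 h2
      refine ⟨y, Or.inl ?_⟩
      convert hy using 3
      rw [hφ, hp]
      push_cast
      field_simp
      ring
    · obtain ⟨y, hy⟩ := exists_spiralRel_circlePoint_int (ℓ := ℓ) (p + ℓ + 1) h1 h2
      refine ⟨-y, Or.inr ?_⟩
      rw [Prod.neg_mk, neg_neg, ← circlePoint_add_pi]
      convert hy using 3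
      rw [hφ, hp]
      push_cast
      field_simp
      ring
  · suffices ∃ x, (x, y) ∈ spiralRel ℓ ∨ -(x, y) ∈ spiralRel ℓ by
      obtain ⟨x, hx⟩ := this
      exact ⟨x, (hsub' _ hx).1, hx⟩
    have hex : ∀ y ∈ usphere (2 * ℓ + 1), 0 ≤ ∑ i : Fin (2 * ℓ + 1), y i.succ →
        ∃ x, (x, y) ∈ spiralRel ℓ := by
      intro y hy h0
      obtain ⟨k, hk⟩ := Finite.exists_max fun i : Fin (2 * ℓ + 1) => y i.succ
      exact ⟨circlePoint ((2 * k * π + Real.arcsin (y 0)) / (2 * ℓ + 1)), hy, h0, k, hk, rfl⟩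
    rcases le_total 0 (∑ i : Fin (2 * ℓ + 1), y i.succ) with h0 | h0
    · obtain ⟨x, hx⟩ := hex y hy h0
      exact ⟨x, Or.inl hx⟩
    · obtain ⟨x, hx⟩ := hex (-y) (neg_mem_usphere hy) (by simpa using h0)
      exact ⟨-x, Or.inr (by simpa using hx)⟩

end UpperBound

/-- For every integer ℓ ≥ 1, twice the Gromov–Hausdorff distance between S^1 and S^{2ℓ+1}
equals 2πℓ/(2ℓ+1). -/
theorem two_dGH_S1_odd (ℓ : ℕ) (hℓ : 1 ≤ ℓ) :
    twoGH 1 (2 * ℓ + 1) = 2 * π * ℓ / (2 * (ℓ : ℝ) + 1) := by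
  have hlower : ∀ R : Set (Euc (1 + 1) × Euc (2 * ℓ + 1 + 1)),
      IsCorrespondence (usphere 1) (usphere (2 * ℓ + 1)) R →
        2 * π * ℓ / (2 * (ℓ : ℝ) + 1) ≤ distortion R := by
    intro R hR
    have hbdd : BddAbove {t | ∃ z ∈ R, ∃ w ∈ R, t = |geoDist z.1 w.1 - geoDist z.2 w.2|} := by
      refine ⟨π, ?_⟩
      rintro t ⟨z, -, w, -, rfl⟩
      exact abs_geoDist_sub_le_pi _ _ _ _
    refine le_of_abs_geoDist_sub_le (by omega) hR ?_ fun z hz w hw =>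
      le_csSup hbdd ⟨z, hz, w, hw, rfl⟩
    refine Real.sSup_nonneg ?_
    rintro t ⟨z, -, w, -, rfl⟩
    exact abs_nonneg _
  have hcorr := isCorrespondence_spiralRel ℓ
  have hne : {t | ∃ z ∈ {z | z ∈ spiralRel ℓ ∨ -z ∈ spiralRel ℓ},
      ∃ w ∈ {z | z ∈ spiralRel ℓ ∨ -z ∈ spiralRel ℓ},
        t = |geoDist z.1 w.1 - geoDist z.2 w.2|}.Nonempty := by
    obtain ⟨y, -, hy⟩ := hcorr.2.1 _ (circlePoint_mem 0)
    exact ⟨_, _, hy, _, hy, rfl⟩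
  refine le_antisymm ?_ ?_
  · have hinf : twoGH 1 (2 * ℓ + 1) ≤
        distortion {z | z ∈ spiralRel ℓ ∨ -z ∈ spiralRel ℓ} := by
      refine csInf_le ⟨2 * π * ℓ / (2 * (ℓ : ℝ) + 1), ?_⟩ ⟨_, hcorr, rfl⟩
      rintro t ⟨R, hR, rfl⟩
      exact hlower R hR
    refine hinf.trans (csSup_le hne ?_)
    rintro t ⟨z, hz, w, hw, rfl⟩
    exact abs_geoDist_sub_le_of_symm (spiralRel_distortion hℓ) hz hw
  · refine le_csInf ⟨_, _, hcorr, rfl⟩ ?_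
    rintro t ⟨R, hR, rfl⟩
    exact hlower R hR
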